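/- arXiv:1912.01655 — 2 statements merged into one kernel-verified Lean document; each statement's English description precedes it below -/
import Mathlib

section
/- Let ν ≥ 3 be an integer and let φ, ψ, χ be holomorphic functions of one complex variable near 0 ∈ ℂ. Set f(z,ζ) := z^{ν−1}φ(ζ), g(z,ζ) := z^{ν−2}ψ(ζ), h(z,ζ) := z^{ν}χ(ζ). Let F = m + G and F' = m + G' be analytic near 0 ∈ ℂ⁴, holomorphic in each variable, satisfying the reality condition, where every Taylor coefficient of G and of G' with a + c ≤ 2 vanishes. Assume 2F(z,ζ,u,v) + h(z,ζ) + h̄(u,v) = 2F'(z + f(z,ζ), ζ + g(z,ζ), u + f̄(u,v), v + ḡ(u,v)) identically near 0. Then: (i) G'_{a,b,c,d} = G_{a,b,c,d} for every (a,b,c,d) with a + c ≤ ν − 1; and (ii) for every (a,b,c,d) with a + c = ν, G'_{a,b,c,d} = G_{a,b,c,d} − Φ_{a,b,c,d}, where Φ_{a,b,c,d} is the Taylor coefficient of z^aζ^bu^cv^d at 0 of Φ(z,ζ,u,v) := ((u + zv)/(1 − ζv))·f(z,ζ) + ((u + zv)²/(2(1 − ζv)²))·g(z,ζ) − (1/2)h(z,ζ)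 + ((z + uζ)/(1 − ζv))·f̄(u,v) + ((z + uζ)²/(2(1 − ζv)²))·ḡ(u,v) − (1/2)h̄(u,v). -/
open Complex Filter Topology ComplexConjugate

/-- Partial derivative in the first (`z`) slot. -/
noncomputable def pdz (F : ℂ → ℂ → ℂ → ℂ → ℂ) : ℂ → ℂ → ℂ → ℂ → ℂ :=
  fun z ζ u v => deriv (fun t => F t ζ u v) z

/-- Partial derivative in the second (`ζ`) slot. -/
noncomputable def pdc (F : ℂ → ℂ → ℂ → ℂ → ℂ) : ℂ → ℂ → ℂ → ℂ → ℂ :=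
  fun z ζ u v => deriv (fun t => F z t u v) ζ

/-- Partial derivative in the third (`u`, i.e. `z̄`) slot. -/
noncomputable def pdu (F : ℂ → ℂ → ℂ → ℂ → ℂ) : ℂ → ℂ → ℂ → ℂ → ℂ :=
  fun z ζ u v => deriv (fun t => F z ζ t v) u

/-- Partial derivative in the fourth (`v`, i.e. `ζ̄`) slot. -/
noncomputable def pdv (F : ℂ → ℂ → ℂ → ℂ → ℂ) : ℂ → ℂ → ℂ → ℂ → ℂ :=
  fun z ζ u v => deriv (fun t => F z ζ u t) v

/-- Polarized rigid graphing function on `ℂ⁴`: analytic near the origin (hence holomorphic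
in each of the four variables) and satisfying the reality condition near the origin. -/
def IsPolarized4 (F : ℂ → ℂ → ℂ → ℂ → ℂ) : Prop :=
  AnalyticAt ℂ (fun p : ℂ × ℂ × ℂ × ℂ => F p.1 p.2.1 p.2.2.1 p.2.2.2) 0 ∧
    ∀ᶠ p : ℂ × ℂ × ℂ × ℂ in 𝓝 0,
      F p.1 p.2.1 p.2.2.1 p.2.2.2 =
        conj (F (conj p.2.2.1) (conj p.2.2.2) (conj p.1) (conj p.2.1))

/-- The Levi determinant `F_{zu}F_{ζv} − F_{ζu}F_{zv}`. -/
noncomputable def Levi (F : ℂ → ℂ → ℂ → ℂ → ℂ) : ℂ → ℂ → ℂ → ℂ → ℂ :=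
  fun z ζ u v =>
    pdz (pdu F) z ζ u v * pdc (pdv F) z ζ u v -
      pdc (pdu F) z ζ u v * pdz (pdv F) z ζ u v

/-- Taylor coefficient of `z^a ζ^b u^c v^d` in the expansion of `F` at the origin. -/
noncomputable def coeff4 (F : ℂ → ℂ → ℂ → ℂ → ℂ) (a b c d : ℕ) : ℂ :=
  (pdz^[a] (pdc^[b] (pdu^[c] (pdv^[d] F)))) 0 0 0 0 /
    ((a.factorial : ℂ) * (b.factorial : ℂ) * (c.factorial : ℂ) * (d.factorial : ℂ))

/-- Partial derivative in the first slot of a function of two variables. -/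
noncomputable def p1 (f : ℂ → ℂ → ℂ) : ℂ → ℂ → ℂ := fun z ζ => deriv (fun t => f t ζ) z

/-- Partial derivative in the second slot of a function of two variables. -/
noncomputable def p2 (f : ℂ → ℂ → ℂ) : ℂ → ℂ → ℂ := fun z ζ => deriv (fun t => f z t) ζ

/-- Jacobian determinant `f_z g_ζ − f_ζ g_z`. -/
noncomputable def Jac (f g : ℂ → ℂ → ℂ) : ℂ → ℂ → ℂ :=
  fun z ζ => p1 f z ζ * p2 g z ζ - p2 f z ζ * p1 g z ζ

/-- Conjugate function `f̄(u,v) := conj (f (conj u) (conj v))`. -/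
noncomputable def bar2 (f : ℂ → ℂ → ℂ) : ℂ → ℂ → ℂ := fun u v => conj (f (conj u) (conj v))

/-- The polarized Gaussier–Merker model. -/
noncomputable def gm : ℂ → ℂ → ℂ → ℂ → ℂ :=
  fun z ζ u v => (z * u + z ^ 2 * v / 2 + u ^ 2 * ζ / 2) / (1 - ζ * v)


/-! ### Directional derivatives of analytic functions -/

section DirDeriv

variable {E : Type*} [NormedAddCommGroup E] [NormedSpace ℂ E]

/-- The derivative of `H` in the direction `e`, as a function of the base point. -/
noncomputable def dirDeriv (e : E) (H : E → ℂ) : E → ℂ := fun p => fderiv ℂ H p e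

theorem AnalyticAt.dirDeriv {H : E → ℂ} {p : E} (h : AnalyticAt ℂ H p) (e : E) :
    AnalyticAt ℂ (dirDeriv e H) p :=
  ((ContinuousLinearMap.apply ℂ ℂ e).analyticAt _).comp h.fderiv

theorem AnalyticAt.iterate_dirDeriv {H : E → ℂ} {p : E} (h : AnalyticAt ℂ H p) (e : E) (k : ℕ) :
    AnalyticAt ℂ ((_root_.dirDeriv e)^[k] H) p := by
  induction k with
  | zero => exact h
  | succ k ih => rw [Function.iterate_succ_apply']; exact ih.dirDeriv e

theorem Filter.EventuallyEq.dirDeriv {H K : E → ℂ} {p : E} (h : H =ᶠ[𝓝 p] K) (e : E) :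
    dirDeriv e H =ᶠ[𝓝 p] dirDeriv e K := by
  filter_upwards [h.fderiv (𝕜 := ℂ)] with x hx
  simp [_root_.dirDeriv, hx]

theorem Filter.EventuallyEq.iterate_dirDeriv {H K : E → ℂ} {p : E} (h : H =ᶠ[𝓝 p] K) (e : E)
    (k : ℕ) : (_root_.dirDeriv e)^[k] H =ᶠ[𝓝 p] (_root_.dirDeriv e)^[k] K := by
  induction k with
  | zero => exact h
  | succ k ih => simp only [Function.iterate_succ_apply']; exact ih.dirDeriv e

theorem dirDeriv_comm {H : E → ℂ} {p : E} (h : AnalyticAt ℂ H p) (e e' : E) :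
    dirDeriv e (dirDeriv e' H) =ᶠ[𝓝 p] dirDeriv e' (dirDeriv e H) := by
  have key : ∀ x, AnalyticAt ℂ H x → ∀ v w : E,
      dirDeriv v (dirDeriv w H) x = fderiv ℂ (fderiv ℂ H) x v w := fun x hx v w => by
    have h1 := (hx.fderiv.differentiableAt.hasFDerivAt.clm_apply (hasFDerivAt_const w x)).fderiv
    change fderiv ℂ (fun y => fderiv ℂ H y w) x v = _
    rw [h1]
    simp
  filter_upwards [h.eventually_analyticAt] with x hx
  rw [key x hx, key x hx]
  exact hx.contDiffAt.isSymmSndFDerivAt_of_omega e e'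

theorem iterate_dirDeriv_comm {H : E → ℂ} {p : E} (h : AnalyticAt ℂ H p) (e e' : E) (k : ℕ) :
    (dirDeriv e)^[k] (dirDeriv e' H) =ᶠ[𝓝 p] dirDeriv e' ((dirDeriv e)^[k] H) := by
  induction k with
  | zero => exact .rfl
  | succ k ih =>
    simp only [Function.iterate_succ_apply']
    exact (ih.dirDeriv e).trans (dirDeriv_comm (h.iterate_dirDeriv e k) e e')

theorem dirDeriv_smul_add {H K : E → ℂ} {p : E} (hH : AnalyticAt ℂ H p) (hK : AnalyticAt ℂ K p)
    (s : ℂ) (e : E) :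
    dirDeriv e (fun x => s * H x + K x) =ᶠ[𝓝 p] fun x => s * dirDeriv e H x + dirDeriv e K x := by
  filter_upwards [hH.eventually_analyticAt, hK.eventually_analyticAt] with x hx hx'
  have h1 := ((hx.differentiableAt.hasFDerivAt.const_mul s).add
    hx'.differentiableAt.hasFDerivAt).fderiv
  change fderiv ℂ (fun y => s * H y + K y) x e = _
  have h2 : (fun y => s * H y + K y) = ((fun y => s * H y) + K) := rfl
  rw [h2, h1]
  simp [dirDeriv]

theorem iterate_dirDeriv_smul_add {H K L : E → ℂ} {p : E} (hH : AnalyticAt ℂ H p)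
    (hK : AnalyticAt ℂ K p) (s : ℂ) (hL : L =ᶠ[𝓝 p] fun x => s * H x + K x) (e : E) (k : ℕ) :
    (dirDeriv e)^[k] L =ᶠ[𝓝 p]
      fun x => s * (dirDeriv e)^[k] H x + (dirDeriv e)^[k] K x := by
  induction k with
  | zero => exact hL
  | succ k ih =>
    simp only [Function.iterate_succ_apply']
    exact (ih.dirDeriv e).trans
      (dirDeriv_smul_add (hH.iterate_dirDeriv e k) (hK.iterate_dirDeriv e k) s e)

theorem hasDerivAt_line {H : E → ℂ} {p e : E} {t : ℂ} (h : AnalyticAt ℂ H (p + t • e)) :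
    HasDerivAt (fun s : ℂ => H (p + s • e)) (dirDeriv e H (p + t • e)) t := by
  have h1 : HasDerivAt (fun s : ℂ => p + s • e) e t := by
    simpa using ((hasDerivAt_id t).smul_const e).const_add p
  exact h.differentiableAt.hasFDerivAt.comp_hasDerivAt t h1

theorem analyticAt_line {H : E → ℂ} {p e : E} {t : ℂ} (h : AnalyticAt ℂ H (p + t • e)) :
    AnalyticAt ℂ (fun s : ℂ => H (p + s • e)) t :=
  AnalyticAt.fun_comp (g := H) (f := fun s : ℂ => p + s • e) h (by fun_prop)

/-- A function analytic on a convex open set whose directional derivatives of all orders vanish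
at one point vanishes along the corresponding line. -/
theorem eq_zero_of_iterate_dirDeriv_eq_zero {H : E → ℂ} {U : Set E} (hU : IsOpen U)
    (hc : Convex ℝ U) (hH : AnalyticOnNhd ℂ H U) {p e : E} (hp : p ∈ U)
    (h0 : ∀ k, (dirDeriv e)^[k] H p = 0) {t : ℂ} (ht : p + t • e ∈ U) : H (p + t • e) = 0 := by
  have hcont : Continuous fun s : ℂ => p + s • e := by fun_prop
  set V : Set ℂ := (fun s : ℂ => p + s • e) ⁻¹' U with hV
  have hVo : IsOpen V := hU.preimage hcont
  have hVc : Convex ℝ V := by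
    intro x hx y hy a b ha hb hab
    have := hc hx hy ha hb hab
    simp only [hV, Set.mem_preimage]
    convert this using 1
    simp only [smul_add, add_smul]
    rw [smul_assoc, smul_assoc, add_add_add_comm, ← add_smul, hab, one_smul]
  have hV0 : (0 : ℂ) ∈ V := by simpa [hV] using hp
  have hit : ∀ k, ∀ s ∈ V,
      iteratedDeriv k (fun s : ℂ => H (p + s • e)) s = (dirDeriv e)^[k] H (p + s • e) := by
    intro k
    induction k with
    | zero => intro s _; simp
    | succ k ih =>
      intro s hs
      rw [iteratedDeriv_succ, Function.iterate_succ_apply']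
      have he : iteratedDeriv k (fun s : ℂ => H (p + s • e)) =ᶠ[𝓝 s]
          fun s => (dirDeriv e)^[k] H (p + s • e) := by
        filter_upwards [hVo.mem_nhds hs] with r hr using ih r hr
      rw [he.deriv_eq]
      exact (hasDerivAt_line ((hH _ hs).iterate_dirDeriv e k)).deriv
  have hg : AnalyticOnNhd ℂ (fun s : ℂ => H (p + s • e)) V := fun s hs => analyticAt_line (hH _ hs)
  have htop : analyticOrderAt (fun s : ℂ => H (p + s • e)) 0 = ⊤ := by
    rw [ENat.eq_top_iff_forall_ge]
    intro n
    rw [natCast_le_analyticOrderAt_iff_iteratedDeriv_eq_zero (hg 0 hV0)]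
    intro i _
    rw [hit i 0 hV0]
    simpa using h0 i
  exact hg.eqOn_zero_of_preconnected_of_eventuallyEq_zero hVc.isPreconnected hV0
    (analyticOrderAt_eq_top.mp htop) ht

/-- Mean value inequality along a segment, in terms of directional derivatives. -/
theorem norm_sub_le_of_dirDeriv_le {H : E → ℂ} {U : Set E} (hc : Convex ℝ U)
    (hH : AnalyticOnNhd ℂ H U) {p e : E} (hp : p ∈ U) (hq : p + e ∈ U) {C : ℝ}
    (hC : ∀ t : ℝ, 0 ≤ t → t ≤ 1 → ‖dirDeriv e H (p + (t : ℂ) • e)‖ ≤ C) :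
    ‖H (p + e) - H p‖ ≤ C := by
  have hmem : ∀ t ∈ Set.Icc (0 : ℝ) 1, p + (t : ℂ) • e ∈ U := fun t ht => by
    have := hc.add_smul_mem hp hq ht
    simpa using this
  have := norm_image_sub_le_of_norm_deriv_le_segment_01'
    (f := fun t : ℝ => H (p + (t : ℂ) • e))
    (f' := fun t : ℝ => dirDeriv e H (p + (t : ℂ) • e)) (C := C)
    (fun t ht => (HasDerivAt.comp_ofReal (hasDerivAt_line (hH _ (hmem t ht)))).hasDerivWithinAt)
    (fun t ht => hC t ht.1 ht.2.le)
  simpa using this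

end DirDeriv

/-! ### Weighted vanishing order -/

/-- The weight of a point of `ℂ⁴`: the first and third coordinates have weight one. -/
noncomputable def wt (p : ℂ × ℂ × ℂ × ℂ) : ℝ := ‖p.1‖ + ‖p.2.2.1‖

theorem wt_nonneg (p : ℂ × ℂ × ℂ × ℂ) : 0 ≤ wt p := by unfold wt; positivity

theorem wt_add_le (p q : ℂ × ℂ × ℂ × ℂ) : wt (p + q) ≤ wt p + wt q := by
  have h1 := norm_add_le p.1 q.1
  have h2 := norm_add_le p.2.2.1 q.2.2.1
  simp only [wt, Prod.fst_add, Prod.snd_add]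
  linarith

theorem wt_smul (s : ℂ) (p : ℂ × ℂ × ℂ × ℂ) : wt (s • p) = ‖s‖ * wt p := by
  simp [wt, mul_add]

theorem wt_le_two_mul_norm (p : ℂ × ℂ × ℂ × ℂ) : wt p ≤ 2 * ‖p‖ := by
  have h1 := norm_fst_le p
  have h2 := (norm_fst_le p.2.2).trans ((norm_snd_le p.2).trans (norm_snd_le p))
  unfold wt
  linarith

theorem continuous_wt : Continuous wt := by unfold wt; fun_prop

/-- `H` vanishes to weighted order at least `n` at the origin. -/
def WeightedO (n : ℕ) (H : ℂ × ℂ × ℂ × ℂ → ℂ) : Prop :=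
  H =O[𝓝 0] fun p => wt p ^ n

theorem isBigO_wt_pow {m n : ℕ} (h : m ≤ n) :
    (fun p => wt p ^ n) =O[𝓝 0] fun p => wt p ^ m := by
  refine Asymptotics.IsBigO.of_bound 1 ?_
  have : ∀ᶠ p in 𝓝 (0 : ℂ × ℂ × ℂ × ℂ), wt p < 1 :=
    continuous_wt.continuousAt.eventually_lt continuousAt_const (by simp [wt])
  filter_upwards [this] with p hp
  have h0 := wt_nonneg p
  rw [Real.norm_of_nonneg (by positivity), Real.norm_of_nonneg (by positivity), one_mul]
  exact pow_le_pow_of_le_one h0 hp.le h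

namespace WeightedO

variable {H K : ℂ × ℂ × ℂ × ℂ → ℂ} {m n : ℕ}

theorem mono (h : WeightedO n H) (hmn : m ≤ n) : WeightedO m H := h.trans (isBigO_wt_pow hmn)

theorem mul (hH : WeightedO m H) (hK : WeightedO n K) : WeightedO (m + n) fun p => H p * K p := by
  unfold WeightedO
  simp only [pow_add]
  exact Asymptotics.IsBigO.mul hH hK

theorem add (hH : WeightedO n H) (hK : WeightedO n K) : WeightedO n fun p => H p + K p :=
  Asymptotics.IsBigO.add hH hK

theorem sub (hH : WeightedO n H) (hK : WeightedO n K) : WeightedO n fun p => H p - K p :=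
  Asymptotics.IsBigO.sub hH hK

theorem of_continuousAt (hH : ContinuousAt H 0) : WeightedO 0 H := by
  unfold WeightedO
  simp only [pow_zero]
  exact hH.norm.isBoundedUnder_le.isBigO_one ℝ

theorem eq_zero (hH : WeightedO (n + 1) H) : H 0 = 0 := by
  obtain ⟨C, hC⟩ := hH.bound
  have := hC.self_of_nhds
  simpa [wt] using this

theorem pow_fst (n : ℕ) : WeightedO n fun p => p.1 ^ n := by
  refine Asymptotics.IsBigO.pow (Asymptotics.IsBigO.of_bound 1 (.of_forall fun p => ?_)) n
  rw [Real.norm_of_nonneg (wt_nonneg p), one_mul]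
  exact le_add_of_nonneg_right (norm_nonneg _)

theorem pow_third (n : ℕ) : WeightedO n fun p => p.2.2.1 ^ n := by
  refine Asymptotics.IsBigO.pow (Asymptotics.IsBigO.of_bound 1 (.of_forall fun p => ?_)) n
  rw [Real.norm_of_nonneg (wt_nonneg p), one_mul]
  exact le_add_of_nonneg_left (norm_nonneg _)

theorem exists_ball (hH : AnalyticAt ℂ H 0) (hO : WeightedO n H) :
    ∃ C r : ℝ, 0 < C ∧ 0 < r ∧ AnalyticOnNhd ℂ H (Metric.ball 0 r) ∧
      ∀ p ∈ Metric.ball (0 : ℂ × ℂ × ℂ × ℂ) r, ‖H p‖ ≤ C * wt p ^ n := by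
  obtain ⟨C, hC, hb⟩ := hO.exists_pos
  obtain ⟨r, hr, h⟩ := Metric.eventually_nhds_iff_ball.mp
    (hH.eventually_analyticAt.and hb.bound)
  refine ⟨C, r, hC, hr, fun p hp => (h p hp).1, fun p hp => ?_⟩
  have := (h p hp).2
  rwa [Real.norm_of_nonneg (pow_nonneg (wt_nonneg p) n)] at this

end WeightedO

/-- Cauchy estimate for a directional derivative. -/
theorem norm_dirDeriv_le {H : ℂ × ℂ × ℂ × ℂ → ℂ} {r R C : ℝ} {p e : ℂ × ℂ × ℂ × ℂ}
    (hH : AnalyticOnNhd ℂ H (Metric.ball 0 r)) (he : ‖e‖ ≤ 1) (hR : 0 < R) (hp : ‖p‖ + R < r)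
    (hC : ∀ s : ℂ, ‖s‖ = R → ‖H (p + s • e)‖ ≤ C) : ‖dirDeriv e H p‖ ≤ C / R := by
  have hmem : ∀ s : ℂ, ‖s‖ ≤ R → p + s • e ∈ Metric.ball (0 : ℂ × ℂ × ℂ × ℂ) r := fun s hs => by
    rw [mem_ball_zero_iff]
    calc ‖p + s • e‖ ≤ ‖p‖ + ‖s‖ * ‖e‖ := (norm_add_le _ _).trans_eq (by rw [norm_smul])
      _ ≤ ‖p‖ + R * 1 := by gcongr
      _ < r := by linarith
  have h0 := hasDerivAt_line (t := 0) (hH _ (hmem 0 (by simpa using hR.le)))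
  have h1 : ‖deriv (fun s : ℂ => H (p + s • e)) 0‖ ≤ C / R := by
    refine Complex.norm_deriv_le_of_forall_mem_sphere_norm_le hR ?_ fun s hs => hC s (by simpa using hs)
    refine DifferentiableOn.diffContOnCl fun s hs => ?_
    have hs' : ‖s‖ ≤ R := by
      simpa using Metric.closure_ball_subset_closedBall hs
    exact (hasDerivAt_line (hH _ (hmem s hs'))).differentiableAt.differentiableWithinAt
  rw [h0.deriv] at h1
  simpa using h1

theorem WeightedO.dirDeriv_of_wt_eq_zero {H : ℂ × ℂ × ℂ × ℂ → ℂ} {n : ℕ} (hO : WeightedO n H)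
    (hH : AnalyticAt ℂ H 0) {e : ℂ × ℂ × ℂ × ℂ} (he : ‖e‖ ≤ 1) (hw : wt e = 0) :
    WeightedO n (dirDeriv e H) := by
  obtain ⟨C, r, hC, hr, hA, hb⟩ := hO.exists_ball hH
  refine Asymptotics.IsBigO.of_bound (C / (r / 4)) ?_
  filter_upwards [Metric.ball_mem_nhds (0 : ℂ × ℂ × ℂ × ℂ) (half_pos hr)] with p hp
  rw [mem_ball_zero_iff] at hp
  rw [Real.norm_of_nonneg (pow_nonneg (wt_nonneg p) n), div_mul_eq_mul_div]
  refine norm_dirDeriv_le hA he (by positivity) (by linarith) fun s hs => ?_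
  have hmem : p + s • e ∈ Metric.ball (0 : ℂ × ℂ × ℂ × ℂ) r := by
    rw [mem_ball_zero_iff]
    calc ‖p + s • e‖ ≤ ‖p‖ + ‖s‖ * ‖e‖ := (norm_add_le _ _).trans_eq (by rw [norm_smul])
      _ ≤ ‖p‖ + r / 4 * 1 := by rw [hs]; gcongr
      _ < r := by linarith
  refine (hb _ hmem).trans ?_
  have h1 : wt (p + s • e) ≤ wt p := by
    have := wt_add_le p (s • e)
    rwa [wt_smul, hw, mul_zero, add_zero] at this
  have := wt_nonneg (p + s • e)
  gcongr

theorem WeightedO.dirDeriv {H : ℂ × ℂ × ℂ × ℂ → ℂ} {n : ℕ} (hO : WeightedO (n + 1) H)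
    (hH : AnalyticAt ℂ H 0) {e : ℂ × ℂ × ℂ × ℂ} (he : ‖e‖ ≤ 1) (hw : wt e ≤ 1) :
    WeightedO n (dirDeriv e H) := by
  obtain ⟨C, r, hC, hr, hA, hb⟩ := hO.exists_ball hH
  have key : ∀ p : ℂ × ℂ × ℂ × ℂ, ‖p‖ < r / 4 → ∀ R, 0 < R → R < r / 2 →
      ‖_root_.dirDeriv e H p‖ ≤ C * (wt p + R) ^ (n + 1) / R := by
    intro p hp R hR hRr
    refine norm_dirDeriv_le hA he hR (by linarith) fun s hs => ?_
    have hmem : p + s • e ∈ Metric.ball (0 : ℂ × ℂ × ℂ × ℂ) r := by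
      rw [mem_ball_zero_iff]
      calc ‖p + s • e‖ ≤ ‖p‖ + ‖s‖ * ‖e‖ := (norm_add_le _ _).trans_eq (by rw [norm_smul])
        _ ≤ ‖p‖ + R * 1 := by rw [hs]; gcongr
        _ < r := by linarith
    refine (hb _ hmem).trans ?_
    have h1 : wt (p + s • e) ≤ wt p + R := by
      have h2 := wt_add_le p (s • e)
      rw [wt_smul, hs] at h2
      nlinarith
    have := wt_nonneg (p + s • e)
    gcongr
  refine Asymptotics.IsBigO.of_bound (C * 2 ^ (n + 1)) ?_
  filter_upwards [Metric.ball_mem_nhds (0 : ℂ × ℂ × ℂ × ℂ) (show 0 < r / 4 by positivity)] with p hp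
  rw [mem_ball_zero_iff] at hp
  rw [Real.norm_of_nonneg (pow_nonneg (wt_nonneg p) n)]
  rcases (wt_nonneg p).eq_or_lt with h0 | h0
  · have h1 : Tendsto (fun R : ℝ => C * R ^ n) (𝓝[>] 0) (𝓝 (C * 0 ^ n)) :=
      ((continuous_const.mul (continuous_pow n)).tendsto 0).mono_left nhdsWithin_le_nhds
    have h2 : ‖_root_.dirDeriv e H p‖ ≤ C * 0 ^ n := by
      refine ge_of_tendsto h1 ?_
      filter_upwards [Ioo_mem_nhdsGT (show (0 : ℝ) < r / 2 by positivity)] with R hR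
      have := key p hp R hR.1 hR.2
      rw [← h0, zero_add, pow_succ, ← mul_assoc, mul_div_cancel_right₀ _ hR.1.ne'] at this
      exact this
    rw [← h0]
    refine h2.trans ?_
    have : (1 : ℝ) ≤ 2 ^ (n + 1) := one_le_pow₀ (by norm_num)
    have h3 : (0 : ℝ) ≤ C * 0 ^ n := by positivity
    nlinarith
  · refine (key p hp (wt p) h0 (by linarith [wt_le_two_mul_norm p])).trans_eq ?_
    rw [← two_mul, mul_pow]
    field_simp
    ring

/-! ### Coordinate directions and Taylor coefficients -/

theorem dirDeriv_eq_sum (H : ℂ × ℂ × ℂ × ℂ → ℂ) (e p : ℂ × ℂ × ℂ × ℂ) :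
    dirDeriv e H p = e.1 * dirDeriv (1, 0, 0, 0) H p + e.2.1 * dirDeriv (0, 1, 0, 0) H p +
      e.2.2.1 * dirDeriv (0, 0, 1, 0) H p + e.2.2.2 * dirDeriv (0, 0, 0, 1) H p := by
  have : e = e.1 • (1, 0, 0, 0) + e.2.1 • (0, 1, 0, 0) + e.2.2.1 • (0, 0, 1, 0) +
      e.2.2.2 • ((0, 0, 0, 1) : ℂ × ℂ × ℂ × ℂ) := by
    ext <;> simp
  unfold dirDeriv
  conv_lhs => rw [this]
  simp only [map_add, map_smul, smul_eq_mul]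

/-- The mixed derivative of order `(a, b, c, d)` along the coordinate directions. -/
noncomputable def mixedDeriv (a b c d : ℕ) (H : ℂ × ℂ × ℂ × ℂ → ℂ) : ℂ × ℂ × ℂ × ℂ → ℂ :=
  (dirDeriv (1, 0, 0, 0))^[a] ((dirDeriv (0, 1, 0, 0))^[b]
    ((dirDeriv (0, 0, 1, 0))^[c] ((dirDeriv (0, 0, 0, 1))^[d] H)))

theorem mixedDeriv_dirDeriv_fst {H : ℂ × ℂ × ℂ × ℂ → ℂ} {p : ℂ × ℂ × ℂ × ℂ}
    (h : AnalyticAt ℂ H p) (a b c d : ℕ) :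
    mixedDeriv a b c d (dirDeriv (1, 0, 0, 0) H) =ᶠ[𝓝 p] mixedDeriv (a + 1) b c d H := by
  have h4 := h.iterate_dirDeriv (0, 0, 0, 1) d
  have h3 := h4.iterate_dirDeriv (0, 0, 1, 0) c
  have e4 := iterate_dirDeriv_comm h (0, 0, 0, 1) (1, 0, 0, 0) d
  have e3 := (e4.iterate_dirDeriv (0, 0, 1, 0) c).trans
    (iterate_dirDeriv_comm h4 (0, 0, 1, 0) (1, 0, 0, 0) c)
  have e2 := (e3.iterate_dirDeriv (0, 1, 0, 0) b).trans
    (iterate_dirDeriv_comm h3 (0, 1, 0, 0) (1, 0, 0, 0) b)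
  exact e2.iterate_dirDeriv (1, 0, 0, 0) a

theorem mixedDeriv_dirDeriv_third {H : ℂ × ℂ × ℂ × ℂ → ℂ} {p : ℂ × ℂ × ℂ × ℂ}
    (h : AnalyticAt ℂ H p) (a b c d : ℕ) :
    mixedDeriv a b c d (dirDeriv (0, 0, 1, 0) H) =ᶠ[𝓝 p] mixedDeriv a b (c + 1) d H := by
  have e4 := iterate_dirDeriv_comm h (0, 0, 0, 1) (0, 0, 1, 0) d
  exact ((e4.iterate_dirDeriv (0, 0, 1, 0) c).iterate_dirDeriv (0, 1, 0, 0) b).iterate_dirDeriv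
    (1, 0, 0, 0) a

theorem mixedDeriv_smul_add {H K L : ℂ × ℂ × ℂ × ℂ → ℂ} {p : ℂ × ℂ × ℂ × ℂ}
    (hH : AnalyticAt ℂ H p) (hK : AnalyticAt ℂ K p) (s : ℂ)
    (hL : L =ᶠ[𝓝 p] fun x => s * H x + K x) (a b c d : ℕ) :
    mixedDeriv a b c d L =ᶠ[𝓝 p] fun x => s * mixedDeriv a b c d H x + mixedDeriv a b c d K x := by
  have h4 := hH.iterate_dirDeriv (0, 0, 0, 1) d
  have k4 := hK.iterate_dirDeriv (0, 0, 0, 1) d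
  have h3 := h4.iterate_dirDeriv (0, 0, 1, 0) c
  have k3 := k4.iterate_dirDeriv (0, 0, 1, 0) c
  exact iterate_dirDeriv_smul_add (h3.iterate_dirDeriv _ b) (k3.iterate_dirDeriv _ b) s
    (iterate_dirDeriv_smul_add h3 k3 s (iterate_dirDeriv_smul_add h4 k4 s
      (iterate_dirDeriv_smul_add hH hK s hL _ d) _ c) _ b) _ a

/-- The mixed derivatives of weighted order below the weighted vanishing order are zero. -/
theorem WeightedO.mixedDeriv_eq_zero {H : ℂ × ℂ × ℂ × ℂ → ℂ} {n : ℕ} (hO : WeightedO n H)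
    (hH : AnalyticAt ℂ H 0) {a b c d : ℕ} (hac : a + c < n) : mixedDeriv a b c d H 0 = 0 := by
  have fixed : ∀ (e : ℂ × ℂ × ℂ × ℂ), ‖e‖ ≤ 1 → wt e = 0 → ∀ (k : ℕ) (n : ℕ)
      (K : ℂ × ℂ × ℂ × ℂ → ℂ), AnalyticAt ℂ K 0 → WeightedO n K →
      WeightedO n ((_root_.dirDeriv e)^[k] K) := by
    intro e he hw k
    induction k with
    | zero => intro n K _ h; exact h
    | succ k ih => intro n K hK h; exact ih n _ (hK.dirDeriv e) (h.dirDeriv_of_wt_eq_zero hK he hw)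
  have drop : ∀ (e : ℂ × ℂ × ℂ × ℂ), ‖e‖ ≤ 1 → wt e ≤ 1 → ∀ (k : ℕ) (n : ℕ)
      (K : ℂ × ℂ × ℂ × ℂ → ℂ), AnalyticAt ℂ K 0 → WeightedO (n + k) K →
      WeightedO n ((_root_.dirDeriv e)^[k] K) := by
    intro e he hw k
    induction k with
    | zero => intro n K _ h; exact h
    | succ k ih => intro n K hK h; exact ih n _ (hK.dirDeriv e) (WeightedO.dirDeriv h hK he hw)
  obtain ⟨j, rfl⟩ : ∃ j, n = j + 1 + a + c := ⟨n - (a + c) - 1, by omega⟩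
  have h4 := hH.iterate_dirDeriv (0, 0, 0, 1) d
  have h3 := h4.iterate_dirDeriv (0, 0, 1, 0) c
  have h2 := h3.iterate_dirDeriv (0, 1, 0, 0) b
  have o4 := fixed (0, 0, 0, 1) (by simp [Prod.norm_def]) (by simp [wt]) d _ _ hH hO
  have o3 := drop (0, 0, 1, 0) (by simp [Prod.norm_def]) (by simp [wt]) c _ _ h4 o4
  have o2 := fixed (0, 1, 0, 0) (by simp [Prod.norm_def]) (by simp [wt]) b _ _ h3 o3
  exact (drop (1, 0, 0, 0) (by simp [Prod.norm_def]) (by simp [wt]) a _ _ h2 o2).eq_zero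

/-- Weighted order of an increment `H (P + δ) - H P`, from the weighted orders of the partial
derivatives of `H` and of the components of `δ`. -/
theorem WeightedO.comp_add_sub {H : ℂ × ℂ × ℂ × ℂ → ℂ} (hH : AnalyticAt ℂ H 0)
    {n₁ n₂ j₁ j₂ N : ℕ} (hN₁ : n₁ + j₁ = N) (hN₂ : n₂ + j₂ = N)
    (h₁ : WeightedO n₁ (_root_.dirDeriv (1, 0, 0, 0) H))
    (h₂ : WeightedO n₂ (_root_.dirDeriv (0, 1, 0, 0) H))
    (h₃ : WeightedO n₁ (_root_.dirDeriv (0, 0, 1, 0) H))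
    (h₄ : WeightedO n₂ (_root_.dirDeriv (0, 0, 0, 1) H))
    {P δ : ℂ × ℂ × ℂ × ℂ → ℂ × ℂ × ℂ × ℂ} (hP : Tendsto P (𝓝 0) (𝓝 0))
    (hδ : Tendsto δ (𝓝 0) (𝓝 0)) {A : ℝ} (hw : ∀ᶠ x in 𝓝 0, wt (P x) + wt (δ x) ≤ A * wt x)
    (d₁ : WeightedO j₁ fun x => (δ x).1) (d₂ : WeightedO j₂ fun x => (δ x).2.1)
    (d₃ : WeightedO j₁ fun x => (δ x).2.2.1) (d₄ : WeightedO j₂ fun x => (δ x).2.2.2) :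
    WeightedO N fun x => H (P x + δ x) - H (P x) := by
  obtain ⟨C₁, hC₁, b₁⟩ := h₁.exists_pos
  obtain ⟨C₂, hC₂, b₂⟩ := h₂.exists_pos
  obtain ⟨C₃, hC₃, b₃⟩ := h₃.exists_pos
  obtain ⟨C₄, hC₄, b₄⟩ := h₄.exists_pos
  obtain ⟨r, hr, hb⟩ := Metric.eventually_nhds_iff_ball.mp
    (hH.eventually_analyticAt.and (b₁.bound.and (b₂.bound.and (b₃.bound.and b₄.bound))))
  have hPδ : Tendsto (fun x => P x + δ x) (𝓝 0) (𝓝 0) := by simpa using hP.add hδ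
  have hball := Metric.ball_mem_nhds (0 : ℂ × ℂ × ℂ × ℂ) hr
  have main : ∀ᶠ x in 𝓝 (0 : ℂ × ℂ × ℂ × ℂ), ‖H (P x + δ x) - H (P x)‖ ≤
      ‖(δ x).1‖ * (C₁ * (A * wt x) ^ n₁) + ‖(δ x).2.1‖ * (C₂ * (A * wt x) ^ n₂) +
      ‖(δ x).2.2.1‖ * (C₃ * (A * wt x) ^ n₁) + ‖(δ x).2.2.2‖ * (C₄ * (A * wt x) ^ n₂) := by
    filter_upwards [hP hball, hPδ hball, hw] with x hx hx' hwx
    have hc := convex_ball (0 : ℂ × ℂ × ℂ × ℂ) r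
    refine norm_sub_le_of_dirDeriv_le hc (fun y hy => (hb y hy).1) hx hx' fun t ht0 ht1 => ?_
    have hmem : P x + (t : ℂ) • δ x ∈ Metric.ball (0 : ℂ × ℂ × ℂ × ℂ) r := by
      simpa using hc.add_smul_mem hx hx' ⟨ht0, ht1⟩
    have hwt : wt (P x + (t : ℂ) • δ x) ≤ A * wt x := by
      refine (wt_add_le _ _).trans (le_trans ?_ hwx)
      rw [wt_smul, Complex.norm_real, Real.norm_of_nonneg ht0]
      have := wt_nonneg (δ x)
      nlinarith
    have hw0 := wt_nonneg (P x + (t : ℂ) • δ x)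
    obtain ⟨-, q₁, q₂, q₃, q₄⟩ := hb _ hmem
    simp only [norm_pow, Real.norm_of_nonneg hw0] at q₁ q₂ q₃ q₄
    rw [dirDeriv_eq_sum]
    refine (norm_add₄_le).trans ?_
    simp only [norm_mul]
    gcongr
    · exact q₁.trans (by gcongr)
    · exact q₂.trans (by gcongr)
    · exact q₃.trans (by gcongr)
    · exact q₄.trans (by gcongr)
  have big : ∀ {n j : ℕ} {D : ℂ × ℂ × ℂ × ℂ → ℂ} (C : ℝ), n + j = N → WeightedO j D →
      (fun x => ‖D x‖ * (C * (A * wt x) ^ n)) =O[𝓝 0] fun x => wt x ^ N := by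
    intro n j D C hn hD
    have h1 : (fun x => C * (A * wt x) ^ n) =O[𝓝 0] fun x => wt x ^ n := by
      simp only [mul_pow]
      exact ((Asymptotics.isBigO_refl _ _).const_mul_left _).const_mul_left _
    have h2 := (Asymptotics.IsBigO.norm_left hD).mul h1
    simpa only [← pow_add, add_comm j n, hn] using h2
  refine Asymptotics.IsBigO.trans (Asymptotics.IsBigO.of_bound 1 ?_)
    ((((big C₁ hN₁ d₁).add (big C₂ hN₂ d₂)).add (big C₃ hN₁ d₃)).add (big C₄ hN₂ d₄))
  filter_upwards [main] with x hx
  rw [one_mul]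
  exact hx.trans (le_abs_self _)

/-- An analytic function whose mixed derivatives of weighted order below `n` vanish at the origin
vanishes to weighted order `n`. -/
theorem WeightedO.of_mixedDeriv_eq_zero (n : ℕ) : ∀ {H : ℂ × ℂ × ℂ × ℂ → ℂ}, AnalyticAt ℂ H 0 →
    (∀ a b c d : ℕ, a + c < n → mixedDeriv a b c d H 0 = 0) → WeightedO n H := by
  induction n with
  | zero => exact fun hH _ => .of_continuousAt hH.continuousAt
  | succ n ih =>
    intro H hH h
    have h₁ : WeightedO n (_root_.dirDeriv (1, 0, 0, 0) H) := ih (hH.dirDeriv _) fun a b c d hac => by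
      rw [(mixedDeriv_dirDeriv_fst hH a b c d).eq_of_nhds]
      exact h _ _ _ _ (by omega)
    have h₃ : WeightedO n (_root_.dirDeriv (0, 0, 1, 0) H) := ih (hH.dirDeriv _) fun a b c d hac => by
      rw [(mixedDeriv_dirDeriv_third hH a b c d).eq_of_nhds]
      exact h _ _ _ _ (by omega)
    have h₂ := of_continuousAt (hH.dirDeriv (0, 1, 0, 0)).continuousAt
    have h₄ := of_continuousAt (hH.dirDeriv (0, 0, 0, 1)).continuousAt
    have hz : ∀ᶠ x in 𝓝 (0 : ℂ × ℂ × ℂ × ℂ), H (0, x.2.1, 0, x.2.2.2) = 0 := by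
      obtain ⟨r, hr, hA⟩ := Metric.eventually_nhds_iff_ball.mp hH.eventually_analyticAt
      have hc := convex_ball (0 : ℂ × ℂ × ℂ × ℂ) r
      filter_upwards [Metric.ball_mem_nhds (0 : ℂ × ℂ × ℂ × ℂ) hr] with x hx
      have hx2 : (0 : ℂ × ℂ × ℂ × ℂ) + x.2.1 • (0, 1, 0, 0) ∈ Metric.ball 0 r := by
        simp [Prod.norm_def] at hx ⊢
        tauto
      have hx4 : (0 : ℂ × ℂ × ℂ × ℂ) + x.2.1 • (0, 1, 0, 0) + x.2.2.2 • (0, 0, 0, 1) ∈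
          Metric.ball 0 r := by
        simp [Prod.norm_def] at hx ⊢
        tauto
      have step := eq_zero_of_iterate_dirDeriv_eq_zero Metric.isOpen_ball hc hA hx2
        (fun d => eq_zero_of_iterate_dirDeriv_eq_zero Metric.isOpen_ball hc
          (fun y hy => (hA y hy).iterate_dirDeriv (0, 0, 0, 1) d) (Metric.mem_ball_self hr)
          (fun b => h 0 b 0 d (by omega)) hx2) hx4
      simpa using step
    have hsub : WeightedO (n + 1) fun x : ℂ × ℂ × ℂ × ℂ =>
        H ((0, x.2.1, 0, x.2.2.2) + (x.1, 0, x.2.2.1, 0)) - H (0, x.2.1, 0, x.2.2.2) := by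
      refine comp_add_sub (P := fun x => (0, x.2.1, 0, x.2.2.2))
        (δ := fun x => (x.1, 0, x.2.2.1, 0)) (A := 1) hH rfl (zero_add (n + 1)) h₁ h₂ h₃ h₄
        ?_ ?_ (.of_forall fun x => by simp [wt]) ?_ (Asymptotics.isBigO_zero _ _) ?_
        (Asymptotics.isBigO_zero _ _)
      · exact Continuous.tendsto' (by fun_prop) _ _ (by simp)
      · exact Continuous.tendsto' (by fun_prop) _ _ (by simp)
      · simpa using pow_fst 1
      · simpa using pow_third 1
    refine Asymptotics.IsBigO.congr' hsub ?_ .rfl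
    filter_upwards [hz] with x hx
    simp [hx]

/-- The uncurried form of a function of four variables. -/
def uncurry4 (F : ℂ → ℂ → ℂ → ℂ → ℂ) : ℂ × ℂ × ℂ × ℂ → ℂ := fun p => F p.1 p.2.1 p.2.2.1 p.2.2.2

theorem deriv_comp_eq_dirDeriv {H K : ℂ × ℂ × ℂ × ℂ → ℂ} {p e : ℂ × ℂ × ℂ × ℂ}
    (hH : AnalyticAt ℂ H p) (hK : K =ᶠ[𝓝 p] H) {γ : ℂ → ℂ × ℂ × ℂ × ℂ} {t : ℂ}
    (hγ : HasDerivAt γ e t) (ht : γ t = p) : deriv (fun s => K (γ s)) t = dirDeriv e H p := by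
  subst ht
  have h1 : (fun s => K (γ s)) =ᶠ[𝓝 t] H ∘ γ := hγ.continuousAt.eventually hK
  rw [h1.deriv_eq]
  exact (hH.differentiableAt.hasFDerivAt.comp_hasDerivAt t hγ).deriv

theorem uncurry4_pdz {F : ℂ → ℂ → ℂ → ℂ → ℂ} {H : ℂ × ℂ × ℂ × ℂ → ℂ} (hH : AnalyticAt ℂ H 0)
    (hF : uncurry4 F =ᶠ[𝓝 0] H) : uncurry4 (pdz F) =ᶠ[𝓝 0] dirDeriv (1, 0, 0, 0) H := by
  filter_upwards [hH.eventually_analyticAt, hF.eventuallyEq_nhds] with p hp hFp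
  exact deriv_comp_eq_dirDeriv hp hFp (γ := fun s => (s, p.2.1, p.2.2.1, p.2.2.2))
    ((hasDerivAt_id _).prodMk ((hasDerivAt_const _ _).prodMk
      ((hasDerivAt_const _ _).prodMk (hasDerivAt_const _ _)))) rfl

theorem uncurry4_pdc {F : ℂ → ℂ → ℂ → ℂ → ℂ} {H : ℂ × ℂ × ℂ × ℂ → ℂ} (hH : AnalyticAt ℂ H 0)
    (hF : uncurry4 F =ᶠ[𝓝 0] H) : uncurry4 (pdc F) =ᶠ[𝓝 0] dirDeriv (0, 1, 0, 0) H := by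
  filter_upwards [hH.eventually_analyticAt, hF.eventuallyEq_nhds] with p hp hFp
  exact deriv_comp_eq_dirDeriv hp hFp (γ := fun s => (p.1, s, p.2.2.1, p.2.2.2))
    ((hasDerivAt_const _ _).prodMk ((hasDerivAt_id _).prodMk
      ((hasDerivAt_const _ _).prodMk (hasDerivAt_const _ _)))) rfl

theorem uncurry4_pdu {F : ℂ → ℂ → ℂ → ℂ → ℂ} {H : ℂ × ℂ × ℂ × ℂ → ℂ} (hH : AnalyticAt ℂ H 0)
    (hF : uncurry4 F =ᶠ[𝓝 0] H) : uncurry4 (pdu F) =ᶠ[𝓝 0] dirDeriv (0, 0, 1, 0) H := by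
  filter_upwards [hH.eventually_analyticAt, hF.eventuallyEq_nhds] with p hp hFp
  exact deriv_comp_eq_dirDeriv hp hFp (γ := fun s => (p.1, p.2.1, s, p.2.2.2))
    ((hasDerivAt_const _ _).prodMk ((hasDerivAt_const _ _).prodMk
      ((hasDerivAt_id _).prodMk (hasDerivAt_const _ _)))) rfl

theorem uncurry4_pdv {F : ℂ → ℂ → ℂ → ℂ → ℂ} {H : ℂ × ℂ × ℂ × ℂ → ℂ} (hH : AnalyticAt ℂ H 0)
    (hF : uncurry4 F =ᶠ[𝓝 0] H) : uncurry4 (pdv F) =ᶠ[𝓝 0] dirDeriv (0, 0, 0, 1) H := by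
  filter_upwards [hH.eventually_analyticAt, hF.eventuallyEq_nhds] with p hp hFp
  exact deriv_comp_eq_dirDeriv hp hFp (γ := fun s => (p.1, p.2.1, p.2.2.1, s))
    ((hasDerivAt_const _ _).prodMk ((hasDerivAt_const _ _).prodMk
      ((hasDerivAt_const _ _).prodMk (hasDerivAt_id _)))) rfl

theorem uncurry4_iterate {op : (ℂ → ℂ → ℂ → ℂ → ℂ) → ℂ → ℂ → ℂ → ℂ → ℂ} {e : ℂ × ℂ × ℂ × ℂ}
    (hop : ∀ {F : ℂ → ℂ → ℂ → ℂ → ℂ} {H : ℂ × ℂ × ℂ × ℂ → ℂ}, AnalyticAt ℂ H 0 →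
      uncurry4 F =ᶠ[𝓝 0] H → uncurry4 (op F) =ᶠ[𝓝 0] dirDeriv e H)
    {F : ℂ → ℂ → ℂ → ℂ → ℂ} {H : ℂ × ℂ × ℂ × ℂ → ℂ} (hH : AnalyticAt ℂ H 0)
    (hF : uncurry4 F =ᶠ[𝓝 0] H) (k : ℕ) :
    uncurry4 (op^[k] F) =ᶠ[𝓝 0] (dirDeriv e)^[k] H := by
  induction k with
  | zero => exact hF
  | succ k ih =>
    simp only [Function.iterate_succ_apply']
    exact hop (hH.iterate_dirDeriv e k) ih

theorem coeff4_eq_mixedDeriv {F : ℂ → ℂ → ℂ → ℂ → ℂ} (hF : AnalyticAt ℂ (uncurry4 F) 0)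
    (a b c d : ℕ) : coeff4 F a b c d = mixedDeriv a b c d (uncurry4 F) 0 /
      ((a.factorial : ℂ) * (b.factorial : ℂ) * (c.factorial : ℂ) * (d.factorial : ℂ)) := by
  have a4 := hF.iterate_dirDeriv (0, 0, 0, 1) d
  have a3 := a4.iterate_dirDeriv (0, 0, 1, 0) c
  have a2 := a3.iterate_dirDeriv (0, 1, 0, 0) b
  have h := uncurry4_iterate uncurry4_pdz a2 (uncurry4_iterate uncurry4_pdc a3
    (uncurry4_iterate uncurry4_pdu a4 (uncurry4_iterate uncurry4_pdv hF .rfl d) c) b) a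
  have h0 := h.eq_of_nhds
  unfold coeff4 mixedDeriv
  rw [← h0]
  rfl

theorem AnalyticAt.conj_conj {φ : ℂ → ℂ} (hφ : AnalyticAt ℂ φ 0) :
    AnalyticAt ℂ (fun w => conj (φ (conj w))) 0 := by
  rw [Complex.analyticAt_iff_eventually_differentiableAt] at hφ ⊢
  have hc : Tendsto (fun w : ℂ => conj w) (𝓝 0) (𝓝 0) :=
    Continuous.tendsto' Complex.continuous_conj _ _ (by simp)
  filter_upwards [hc.eventually hφ] with w hw
  have := hw.conj_conj
  simpa [Function.comp_def] using this

/-- The remainder in the first order expansion of the model is quadratic in the increments. -/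
theorem gm_add_sub_eq {z ζ u v f g f' g' : ℂ} (h : 1 - ζ * v ≠ 0)
    (h' : 1 - (ζ + g) * (v + g') ≠ 0) :
    gm (z + f) (ζ + g) (u + f') (v + g') - gm z ζ u v -
      ((u + z * v) * (1 - ζ * v)⁻¹ * f +
        (u + z * v) * (u + z * v) * ((1 - ζ * v)⁻¹ * (1 - ζ * v)⁻¹ * 2⁻¹) * g +
        (z + u * ζ) * (1 - ζ * v)⁻¹ * f' +
        (z + u * ζ) * (z + u * ζ) * ((1 - ζ * v)⁻¹ * (1 - ζ * v)⁻¹ * 2⁻¹) * g') =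
    (z * u + z * z * (v / 2) + u * u * (ζ / 2)) * ((1 - ζ * v)⁻¹ * (1 - ζ * v)⁻¹) *
        (g * g' + (1 - (ζ + g) * (v + g'))⁻¹ *
          ((ζ * g' + v * g + g * g') * (ζ * g' + v * g + g * g'))) +
      (u * f + z * f' + v * (z * f) + 2⁻¹ * (z * z * g') + ζ * (u * f') + 2⁻¹ * (u * u * g)) *
        ((1 - ζ * v)⁻¹ * (1 - (ζ + g) * (v + g'))⁻¹) * (ζ * g' + v * g + g * g') +
      (f * f' + f * f * (v / 2) + z * f * g' + f * f * g' * 2⁻¹ + f' * f' * (ζ / 2) +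
        u * f' * g + f' * f' * g * 2⁻¹) * (1 - (ζ + g) * (v + g'))⁻¹ := by
  have hq := inv_mul_cancel₀ h
  have hq' := inv_mul_cancel₀ h'
  unfold gm
  simp only [div_eq_mul_inv]
  generalize (1 - ζ * v)⁻¹ = q at *
  generalize (1 - (ζ + g) * (v + g'))⁻¹ = q' at *
  have hE : q' - q - q * q' * (ζ * g' + v * g + g * g') = 0 := by
    linear_combination (-q') * hq + q * hq'
  linear_combination ((z * u + z ^ 2 * v / 2 + u ^ 2 * ζ / 2) *
    (1 + q * (ζ * g' + v * g + g * g')) + (u * f + z * f' + v * z * f + z ^ 2 * g' / 2 +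
      ζ * u * f' + u ^ 2 * g / 2)) * hE - (u ^ 2 * g / 2 + z ^ 2 * g' / 2) * q * hq

/-- effect of a weighted homogeneous rigid biholomorphism
`z' = z + z^{ν−1}φ(ζ)`, `ζ' = ζ + z^{ν−2}ψ(ζ)`, `w' = w + z^νχ(ζ)` on the weighted
homogeneous components of the remainder `G`: components of weight `≤ ν − 1` are untouched,
and the component of weight `ν` changes by subtraction of the freedom function `Φ`. -/
theorem stmt12
    (ν : ℕ) (hν : 3 ≤ ν) (φ ψ χ : ℂ → ℂ)
    (hφ : AnalyticAt ℂ φ 0) (hψ : AnalyticAt ℂ ψ 0) (hχ : AnalyticAt ℂ χ 0)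
    (G G' : ℂ → ℂ → ℂ → ℂ → ℂ)
    (hG : IsPolarized4 (fun z ζ u v => gm z ζ u v + G z ζ u v))
    (hG' : IsPolarized4 (fun z ζ u v => gm z ζ u v + G' z ζ u v))
    (hGlow : ∀ a b c d : ℕ, a + c ≤ 2 → coeff4 G a b c d = 0)
    (hG'low : ∀ a b c d : ℕ, a + c ≤ 2 → coeff4 G' a b c d = 0)
    (hfund : ∀ᶠ p : ℂ × ℂ × ℂ × ℂ in 𝓝 0,
      2 * (gm p.1 p.2.1 p.2.2.1 p.2.2.2 + G p.1 p.2.1 p.2.2.1 p.2.2.2) +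
          p.1 ^ ν * χ p.2.1 + conj ((conj p.2.2.1) ^ ν * χ (conj p.2.2.2)) =
        2 * (gm (p.1 + p.1 ^ (ν - 1) * φ p.2.1) (p.2.1 + p.1 ^ (ν - 2) * ψ p.2.1)
                (p.2.2.1 + conj ((conj p.2.2.1) ^ (ν - 1) * φ (conj p.2.2.2)))
                (p.2.2.2 + conj ((conj p.2.2.1) ^ (ν - 2) * ψ (conj p.2.2.2))) +
             G' (p.1 + p.1 ^ (ν - 1) * φ p.2.1) (p.2.1 + p.1 ^ (ν - 2) * ψ p.2.1)
                (p.2.2.1 + conj ((conj p.2.2.1) ^ (ν - 1) * φ (conj p.2.2.2)))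
                (p.2.2.2 + conj ((conj p.2.2.1) ^ (ν - 2) * ψ (conj p.2.2.2))))) :
    (∀ a b c d : ℕ, a + c ≤ ν - 1 → coeff4 G' a b c d = coeff4 G a b c d) ∧
      (∀ a b c d : ℕ, a + c = ν →
        coeff4 G' a b c d = coeff4 G a b c d -
          coeff4 (fun z ζ u v =>
            (u + z * v) / (1 - ζ * v) * (z ^ (ν - 1) * φ ζ) +
              (u + z * v) ^ 2 / (2 * (1 - ζ * v) ^ 2) * (z ^ (ν - 2) * ψ ζ) -
              (1 / 2) * (z ^ ν * χ ζ) +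
              (z + u * ζ) / (1 - ζ * v) * conj ((conj u) ^ (ν - 1) * φ (conj v)) +
              (z + u * ζ) ^ 2 / (2 * (1 - ζ * v) ^ 2) *
                conj ((conj u) ^ (ν - 2) * ψ (conj v)) -
              (1 / 2) * conj ((conj u) ^ ν * χ (conj v))) a b c d) := by
  obtain ⟨k, rfl⟩ : ∃ k, ν = k + 2 := ⟨ν - 2, by omega⟩
  have hk : 1 ≤ k := by omega
  rw [show k + 2 - 1 = k + 1 from rfl, show k + 2 - 2 = k from rfl] at *
  have hφ' := hφ.conj_conj
  have hψ' := hψ.conj_conj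
  have hχ' := hχ.conj_conj
  simp only [map_mul, map_pow, Complex.conj_conj] at hfund ⊢
  set φ' : ℂ → ℂ := fun w => conj (φ (conj w)) with hφ'_def
  set ψ' : ℂ → ℂ := fun w => conj (ψ (conj w)) with hψ'_def
  set χ' : ℂ → ℂ := fun w => conj (χ (conj w)) with hχ'_def
  change ∀ᶠ p : ℂ × ℂ × ℂ × ℂ in 𝓝 0,
      2 * (gm p.1 p.2.1 p.2.2.1 p.2.2.2 + G p.1 p.2.1 p.2.2.1 p.2.2.2) +
          p.1 ^ (k + 2) * χ p.2.1 + p.2.2.1 ^ (k + 2) * χ' p.2.2.2 =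
        2 * (gm (p.1 + p.1 ^ (k + 1) * φ p.2.1) (p.2.1 + p.1 ^ k * ψ p.2.1)
                (p.2.2.1 + p.2.2.1 ^ (k + 1) * φ' p.2.2.2) (p.2.2.2 + p.2.2.1 ^ k * ψ' p.2.2.2) +
             G' (p.1 + p.1 ^ (k + 1) * φ p.2.1) (p.2.1 + p.1 ^ k * ψ p.2.1)
                (p.2.2.1 + p.2.2.1 ^ (k + 1) * φ' p.2.2.2)
                (p.2.2.2 + p.2.2.1 ^ k * ψ' p.2.2.2)) at hfund
  change _ ∧ ∀ a b c d : ℕ, a + c = k + 2 → coeff4 G' a b c d = coeff4 G a b c d -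
    coeff4 (fun z ζ u v =>
            (u + z * v) / (1 - ζ * v) * (z ^ (k + 1) * φ ζ) +
              (u + z * v) ^ 2 / (2 * (1 - ζ * v) ^ 2) * (z ^ k * ψ ζ) -
              (1 / 2) * (z ^ (k + 2) * χ ζ) +
              (z + u * ζ) / (1 - ζ * v) * (u ^ (k + 1) * φ' v) +
              (z + u * ζ) ^ 2 / (2 * (1 - ζ * v) ^ 2) * (u ^ k * ψ' v) -
              (1 / 2) * (u ^ (k + 2) * χ' v)) a b c d
  set Φ : ℂ → ℂ → ℂ → ℂ → ℂ := fun z ζ u v =>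
            (u + z * v) / (1 - ζ * v) * (z ^ (k + 1) * φ ζ) +
              (u + z * v) ^ 2 / (2 * (1 - ζ * v) ^ 2) * (z ^ k * ψ ζ) -
              (1 / 2) * (z ^ (k + 2) * χ ζ) +
              (z + u * ζ) / (1 - ζ * v) * (u ^ (k + 1) * φ' v) +
              (z + u * ζ) ^ 2 / (2 * (1 - ζ * v) ^ 2) * (u ^ k * ψ' v) -
              (1 / 2) * (u ^ (k + 2) * χ' v) with hΦ_def
  -- analyticity of the ingredients
  have a₁ : AnalyticAt ℂ (fun p : ℂ × ℂ × ℂ × ℂ => p.1) 0 := analyticAt_fst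
  have a₂ : AnalyticAt ℂ (fun p : ℂ × ℂ × ℂ × ℂ => p.2.1) 0 :=
    (ContinuousLinearMap.fst ℂ ℂ (ℂ × ℂ) ∘L ContinuousLinearMap.snd ℂ ℂ (ℂ × ℂ × ℂ)).analyticAt 0
  have a₃ : AnalyticAt ℂ (fun p : ℂ × ℂ × ℂ × ℂ => p.2.2.1) 0 :=
    (ContinuousLinearMap.fst ℂ ℂ ℂ ∘L ContinuousLinearMap.snd ℂ ℂ (ℂ × ℂ) ∘L
      ContinuousLinearMap.snd ℂ ℂ (ℂ × ℂ × ℂ)).analyticAt 0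
  have a₄ : AnalyticAt ℂ (fun p : ℂ × ℂ × ℂ × ℂ => p.2.2.2) 0 :=
    (ContinuousLinearMap.snd ℂ ℂ ℂ ∘L ContinuousLinearMap.snd ℂ ℂ (ℂ × ℂ) ∘L
      ContinuousLinearMap.snd ℂ ℂ (ℂ × ℂ × ℂ)).analyticAt 0
  have aφ : AnalyticAt ℂ (fun p : ℂ × ℂ × ℂ × ℂ => φ p.2.1) 0 :=
    AnalyticAt.fun_comp (g := φ) (f := fun p : ℂ × ℂ × ℂ × ℂ => p.2.1) hφ a₂
  have aψ : AnalyticAt ℂ (fun p : ℂ × ℂ × ℂ × ℂ => ψ p.2.1) 0 :=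
    AnalyticAt.fun_comp (g := ψ) (f := fun p : ℂ × ℂ × ℂ × ℂ => p.2.1) hψ a₂
  have aχ : AnalyticAt ℂ (fun p : ℂ × ℂ × ℂ × ℂ => χ p.2.1) 0 :=
    AnalyticAt.fun_comp (g := χ) (f := fun p : ℂ × ℂ × ℂ × ℂ => p.2.1) hχ a₂
  have aφ' : AnalyticAt ℂ (fun p : ℂ × ℂ × ℂ × ℂ => φ' p.2.2.2) 0 :=
    AnalyticAt.fun_comp (g := φ') (f := fun p : ℂ × ℂ × ℂ × ℂ => p.2.2.2) hφ' a₄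
  have aψ' : AnalyticAt ℂ (fun p : ℂ × ℂ × ℂ × ℂ => ψ' p.2.2.2) 0 :=
    AnalyticAt.fun_comp (g := ψ') (f := fun p : ℂ × ℂ × ℂ × ℂ => p.2.2.2) hψ' a₄
  have aχ' : AnalyticAt ℂ (fun p : ℂ × ℂ × ℂ × ℂ => χ' p.2.2.2) 0 :=
    AnalyticAt.fun_comp (g := χ') (f := fun p : ℂ × ℂ × ℂ × ℂ => p.2.2.2) hχ' a₄
  have aq : AnalyticAt ℂ (fun p : ℂ × ℂ × ℂ × ℂ => (1 - p.2.1 * p.2.2.2)⁻¹) 0 :=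
    AnalyticAt.fun_inv (by fun_prop) (by simp)
  have agm : AnalyticAt ℂ (uncurry4 gm) 0 := by
    unfold uncurry4 gm
    simp only [div_eq_mul_inv]
    fun_prop
  have aG : AnalyticAt ℂ (uncurry4 G) 0 := by
    have e : uncurry4 G = fun p => (gm p.1 p.2.1 p.2.2.1 p.2.2.2 + G p.1 p.2.1 p.2.2.1 p.2.2.2) -
        uncurry4 gm p := funext fun p => by simp [uncurry4]
    rw [e]
    exact hG.1.fun_sub agm
  have aG' : AnalyticAt ℂ (uncurry4 G') 0 := by
    have e : uncurry4 G' = fun p => (gm p.1 p.2.1 p.2.2.1 p.2.2.2 + G' p.1 p.2.1 p.2.2.1 p.2.2.2) -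
        uncurry4 gm p := funext fun p => by simp [uncurry4]
    rw [e]
    exact hG'.1.fun_sub agm
  have aΦ : AnalyticAt ℂ (uncurry4 Φ) 0 := by
    simp only [hΦ_def]
    unfold uncurry4
    simp only [div_eq_mul_inv, mul_inv, ← inv_pow]
    fun_prop
  -- weighted orders of the ingredients
  have cont : ∀ {H : ℂ × ℂ × ℂ × ℂ → ℂ}, AnalyticAt ℂ H 0 → WeightedO 0 H :=
    fun h => .of_continuousAt h.continuousAt
  have oz : WeightedO 1 fun p => p.1 := by simpa using WeightedO.pow_fst 1
  have ou : WeightedO 1 fun p => p.2.2.1 := by simpa using WeightedO.pow_third 1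
  have oζ : WeightedO 0 fun p => p.2.1 := cont (by fun_prop)
  have ov : WeightedO 0 fun p => p.2.2.2 := cont (by fun_prop)
  have oζ2 : WeightedO 0 fun p => p.2.1 / 2 := cont (by fun_prop)
  have ov2 : WeightedO 0 fun p => p.2.2.2 / 2 := cont (by fun_prop)
  have o2 : WeightedO 0 fun _ => 2⁻¹ := cont (by fun_prop)
  have oq := cont aq
  have oF : WeightedO (k + 1) fun p => p.1 ^ (k + 1) * φ p.2.1 :=
    (WeightedO.pow_fst (k + 1)).mul (cont aφ)
  have og : WeightedO k fun p => p.1 ^ k * ψ p.2.1 := (WeightedO.pow_fst k).mul (cont aψ)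
  have oF' : WeightedO (k + 1) fun p => p.2.2.1 ^ (k + 1) * φ' p.2.2.2 :=
    (WeightedO.pow_third (k + 1)).mul (cont aφ')
  have og' : WeightedO k fun p => p.2.2.1 ^ k * ψ' p.2.2.2 :=
    (WeightedO.pow_third k).mul (cont aψ')
  have oh : WeightedO (k + 2) fun p => p.1 ^ (k + 2) * χ p.2.1 :=
    (WeightedO.pow_fst (k + 2)).mul (cont aχ)
  have oh' : WeightedO (k + 2) fun p => p.2.2.1 ^ (k + 2) * χ' p.2.2.2 :=
    (WeightedO.pow_third (k + 2)).mul (cont aχ')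
  have aD : AnalyticAt ℂ (fun p : ℂ × ℂ × ℂ × ℂ =>
      1 - (p.2.1 + p.1 ^ k * ψ p.2.1) * (p.2.2.2 + p.2.2.1 ^ k * ψ' p.2.2.2)) 0 := by fun_prop
  have hk0 : k ≠ 0 := by omega
  have aq' := aD.fun_inv (by simp [hk0])
  have oq' := cont aq'
  have hq0 : ∀ᶠ p : ℂ × ℂ × ℂ × ℂ in 𝓝 0, 1 - p.2.1 * p.2.2.2 ≠ 0 :=
    ContinuousAt.eventually_ne (by fun_prop) (by simp)
  have hD0 : ∀ᶠ p : ℂ × ℂ × ℂ × ℂ in 𝓝 0,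
      1 - (p.2.1 + p.1 ^ k * ψ p.2.1) * (p.2.2.2 + p.2.2.1 ^ k * ψ' p.2.2.2) ≠ 0 :=
    aD.continuousAt.eventually_ne (by simp [hk0])
  have ouv := ou.add (oz.mul ov)
  have ozu := oz.add (ou.mul oζ)
  -- the linear term
  let L : ℂ × ℂ × ℂ × ℂ → ℂ := fun p =>
    (p.2.2.1 + p.1 * p.2.2.2) * (1 - p.2.1 * p.2.2.2)⁻¹ * (p.1 ^ (k + 1) * φ p.2.1) +
      (p.2.2.1 + p.1 * p.2.2.2) * (p.2.2.1 + p.1 * p.2.2.2) *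
        ((1 - p.2.1 * p.2.2.2)⁻¹ * (1 - p.2.1 * p.2.2.2)⁻¹ * 2⁻¹) * (p.1 ^ k * ψ p.2.1) +
      (p.1 + p.2.2.1 * p.2.1) * (1 - p.2.1 * p.2.2.2)⁻¹ * (p.2.2.1 ^ (k + 1) * φ' p.2.2.2) +
      (p.1 + p.2.2.1 * p.2.1) * (p.1 + p.2.2.1 * p.2.1) *
        ((1 - p.2.1 * p.2.2.2)⁻¹ * (1 - p.2.1 * p.2.2.2)⁻¹ * 2⁻¹) * (p.2.2.1 ^ k * ψ' p.2.2.2)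
  have oqq := (oq.mul oq).mul o2
  have oL : WeightedO (k + 2) L :=
    (((((ouv.mul oq).mul oF).mono (by omega)).add
      ((((ouv.mul ouv).mul oqq).mul og).mono (by omega))).add
      (((ozu.mul oq).mul oF').mono (by omega))).add
      ((((ozu.mul ozu).mul oqq).mul og').mono (by omega))
  have hΦL : ∀ p, uncurry4 Φ p = L p - 2⁻¹ * (p.1 ^ (k + 2) * χ p.2.1) -
      2⁻¹ * (p.2.2.1 ^ (k + 2) * χ' p.2.2.2) := fun p => by
    simp only [uncurry4, hΦ_def, L, div_eq_mul_inv, mul_inv, ← inv_pow]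
    ring
  have oΦ : WeightedO (k + 2) (uncurry4 Φ) := by
    rw [funext hΦL]
    exact (oL.sub ((o2.mul oh).mono (by omega))).sub ((o2.mul oh').mono (by omega))
  -- the model part
  have os : WeightedO k fun p : ℂ × ℂ × ℂ × ℂ => p.2.1 * (p.2.2.1 ^ k * ψ' p.2.2.2) +
      p.2.2.2 * (p.1 ^ k * ψ p.2.1) + p.1 ^ k * ψ p.2.1 * (p.2.2.1 ^ k * ψ' p.2.2.2) :=
    (((oζ.mul og').mono (by omega)).add ((ov.mul og).mono (by omega))).add
      ((og.mul og').mono (by omega))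
  have oN := ((oz.mul ou).add ((oz.mul oz).mul ov2)).add ((ou.mul ou).mul oζ2)
  have oN₁ := ((((((ou.mul oF).mono (show k + 2 ≤ _ by omega)).add
    ((oz.mul oF').mono (by omega))).add ((ov.mul (oz.mul oF)).mono (by omega))).add
    ((o2.mul ((oz.mul oz).mul og')).mono (by omega))).add
    ((oζ.mul (ou.mul oF')).mono (by omega))).add ((o2.mul ((ou.mul ou).mul og)).mono (by omega))
  have oN₂ := (((((((oF.mul oF').mono (show k + 3 ≤ _ by omega)).add
    (((oF.mul oF).mul ov2).mono (by omega))).add (((oz.mul oF).mul og').mono (by omega))).add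
    ((((oF.mul oF).mul og').mul o2).mono (by omega))).add
    (((oF'.mul oF').mul oζ2).mono (by omega))).add (((ou.mul oF').mul og).mono (by omega))).add
    ((((oF'.mul oF').mul og).mul o2).mono (by omega))
  have oss := ((og.mul og').mono (show k + 1 ≤ _ by omega)).add
    ((oq'.mul (os.mul os)).mono (by omega))
  have oM : WeightedO (k + 3) fun p =>
      gm (p.1 + p.1 ^ (k + 1) * φ p.2.1) (p.2.1 + p.1 ^ k * ψ p.2.1)
        (p.2.2.1 + p.2.2.1 ^ (k + 1) * φ' p.2.2.2) (p.2.2.2 + p.2.2.1 ^ k * ψ' p.2.2.2) -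
        gm p.1 p.2.1 p.2.2.1 p.2.2.2 - L p := by
    refine Asymptotics.IsBigO.congr' (((((oN.mul (oq.mul oq)).mul oss).mono
      (show k + 3 ≤ _ by omega)).add (((oN₁.mul (oq.mul oq')).mul os).mono (by omega))).add
      ((oN₂.mul oq').mono (by omega))) ?_ .rfl
    filter_upwards [hq0, hD0] with p h h'
    exact (gm_add_sub_eq h h').symm
  -- the part coming from the remainder
  have oG' : WeightedO 3 (uncurry4 G') := .of_mixedDeriv_eq_zero 3 aG' fun a b c d hac => by
    have := hG'low a b c d (by omega)
    rw [coeff4_eq_mixedDeriv aG', div_eq_zero_iff] at this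
    refine this.resolve_right ?_
    simp [Nat.factorial_ne_zero]
  let δ : ℂ × ℂ × ℂ × ℂ → ℂ × ℂ × ℂ × ℂ := fun p =>
    (p.1 ^ (k + 1) * φ p.2.1, p.1 ^ k * ψ p.2.1, p.2.2.1 ^ (k + 1) * φ' p.2.2.2,
      p.2.2.1 ^ k * ψ' p.2.2.2)
  have hδ : Tendsto δ (𝓝 0) (𝓝 0) := by
    have : ContinuousAt δ 0 := by
      have := aφ.continuousAt
      have := aψ.continuousAt
      have := aφ'.continuousAt
      have := aψ'.continuousAt
      fun_prop
    have h0 : δ 0 = 0 := by simp [δ, hk0]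
    rw [ContinuousAt, h0] at this
    exact this
  obtain ⟨A, hA⟩ : ∃ A : ℝ, ∀ᶠ x in 𝓝 (0 : ℂ × ℂ × ℂ × ℂ), wt x + wt (δ x) ≤ A * wt x := by
    obtain ⟨A₁, h₁⟩ := (oF.mono (show 1 ≤ k + 1 by omega)).bound
    obtain ⟨A₂, h₂⟩ := (oF'.mono (show 1 ≤ k + 1 by omega)).bound
    refine ⟨1 + A₁ + A₂, ?_⟩
    filter_upwards [h₁, h₂] with x hx₁ hx₂
    rw [pow_one, Real.norm_of_nonneg (wt_nonneg x)] at hx₁ hx₂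
    have : wt (δ x) = ‖x.1 ^ (k + 1) * φ x.2.1‖ + ‖x.2.2.1 ^ (k + 1) * φ' x.2.2.2‖ := rfl
    linarith
  have oI : WeightedO (k + 3) fun p => uncurry4 G' (p + δ p) - uncurry4 G' p :=
    WeightedO.comp_add_sub (P := id) aG' (n₁ := 2) (n₂ := 3) (by omega) (by omega)
      (oG'.dirDeriv aG' (by simp [Prod.norm_def]) (by simp [wt]))
      (oG'.dirDeriv_of_wt_eq_zero aG' (by simp [Prod.norm_def]) (by simp [wt]))
      (oG'.dirDeriv aG' (by simp [Prod.norm_def]) (by simp [wt]))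
      (oG'.dirDeriv_of_wt_eq_zero aG' (by simp [Prod.norm_def]) (by simp [wt]))
      tendsto_id hδ hA oF og oF' og'
  -- comparison of coefficients
  let R : ℂ × ℂ × ℂ × ℂ → ℂ := fun p => uncurry4 G' p + uncurry4 Φ p - uncurry4 G p
  have aR : AnalyticAt ℂ R 0 := (aG'.add aΦ).sub aG
  have oR : WeightedO (k + 3) R := by
    refine Asymptotics.IsBigO.congr' (oM.add oI).neg_left ?_ .rfl
    filter_upwards [hfund] with p hp
    simp only [R, hΦL]
    simp only [uncurry4, δ, Prod.fst_add, Prod.snd_add]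
    linear_combination (1 / 2 : ℂ) * hp
  have hmix : ∀ a b c d, mixedDeriv a b c d (uncurry4 G') 0 = mixedDeriv a b c d (uncurry4 G) 0 -
      mixedDeriv a b c d (uncurry4 Φ) 0 + mixedDeriv a b c d R 0 := fun a b c d => by
    have aGR : AnalyticAt ℂ (fun p => 1 * uncurry4 G p + R p) 0 := by fun_prop
    have e₁ := (mixedDeriv_smul_add aG aR 1 .rfl a b c d).eq_of_nhds
    have e₂ := (mixedDeriv_smul_add (L := uncurry4 G') aΦ aGR (-1)
      (.of_eq (funext fun p => by simp only [R]; ring)) a b c d).eq_of_nhds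
    rw [e₂, e₁]
    ring
  refine ⟨fun a b c d hac => ?_, fun a b c d hac => ?_⟩
  · rw [coeff4_eq_mixedDeriv aG', coeff4_eq_mixedDeriv aG, hmix,
      oR.mixedDeriv_eq_zero aR (by omega), oΦ.mixedDeriv_eq_zero aΦ (by omega), sub_zero, add_zero]
  · rw [coeff4_eq_mixedDeriv aG', coeff4_eq_mixedDeriv aG, coeff4_eq_mixedDeriv aΦ, hmix,
      oR.mixedDeriv_eq_zero aR (by omega), add_zero, sub_div]
end

section
/- Let ν ≥ 5 be an integer, and let φ, ψ, χ be holomorphic functions of one complex variable near 0 ∈ ℂ. Define, near 0 ∈ ℂ⁴, the analytic function Φ(z,ζ,u,v) := ((u + zv)/(1 − ζv))·z^{ν−1}φ(ζ) + ((u + zv)²/(2(1 − ζv)²))·z^{ν−2}ψ(ζ) − (1/2)z^{ν}χ(ζ) + ((z + uζ)/(1 − ζv))·u^{ν−1}φ̄(v) + ((z + uζ)²/(2(1 − ζv)²))·u^{ν−2}ψ̄(v) − (1/2)u^{ν}χ̄(v), where φ̄(v) := conj(φ(conj v)) and similarly for ψ̄, χ̄. If every Taylor coefficient of Φ at the origin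 attached to a monomial z^a ζ^b u^c v^d with c ≤ 2 and d = 0 vanishes, then φ ≡ 0, ψ ≡ 0 and χ ≡ 0 near 0. -/
open Complex Filter Topology ComplexConjugate

lemma pdz_iterate (F : ℂ → ℂ → ℂ → ℂ → ℂ) (n : ℕ) (z ζ u v : ℂ) :
    (pdz^[n] F) z ζ u v = iteratedDeriv n (fun t => F t ζ u v) z := by
  induction n generalizing z with
  | zero => simp
  | succ n ih =>
    rw [Function.iterate_succ_apply', iteratedDeriv_succ]
    exact congrArg (fun g => deriv g z) (funext ih)

lemma pdc_iterate (F : ℂ → ℂ → ℂ → ℂ → ℂ) (n : ℕ) (z ζ u v : ℂ) :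
    (pdc^[n] F) z ζ u v = iteratedDeriv n (fun t => F z t u v) ζ := by
  induction n generalizing ζ with
  | zero => simp
  | succ n ih =>
    rw [Function.iterate_succ_apply', iteratedDeriv_succ]
    exact congrArg (fun g => deriv g ζ) (funext ih)

lemma pdu_iterate (F : ℂ → ℂ → ℂ → ℂ → ℂ) (n : ℕ) (z ζ u v : ℂ) :
    (pdu^[n] F) z ζ u v = iteratedDeriv n (fun t => F z ζ t v) u := by
  induction n generalizing u with
  | zero => simp
  | succ n ih =>
    rw [Function.iterate_succ_apply', iteratedDeriv_succ]
    exact congrArg (fun g => deriv g u) (funext ih)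

/-- An analytic function all of whose derivatives vanish at a point vanishes near that point. -/
lemma AnalyticAt.eventually_eq_zero_of_iteratedDeriv {f : ℂ → ℂ} {x : ℂ} (hf : AnalyticAt ℂ f x)
    (h : ∀ n, iteratedDeriv n f x = 0) : ∀ᶠ t in 𝓝 x, f t = 0 := by
  have hp := hf.hasFPowerSeriesAt
  simp only [h, zero_div] at hp
  have h0 : FormalMultilinearSeries.ofScalars ℂ (fun _ => (0 : ℂ)) = 0 := by
    ext n
    simp [FormalMultilinearSeries.ofScalars]
  rw [h0] at hp
  exact hp.eventually_eq_zero

/-- If the `u`-derivative of order `c` of `F` on `u = v = 0` is `k z ^ m f(ζ)`, then the vanishing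
of the corresponding Taylor coefficients of `F` forces `f` to vanish near the origin. -/
lemma eventually_eq_zero_of_coeff4 {F : ℂ → ℂ → ℂ → ℂ → ℂ} {f : ℂ → ℂ} {k : ℂ} {m c : ℕ}
    (hf : AnalyticAt ℂ f 0) (hk : k ≠ 0)
    (hF : ∀ z ζ, iteratedDeriv c (fun u => F z ζ u 0) 0 = k * (z ^ m * f ζ))
    (h : ∀ b, coeff4 F m b c 0 = 0) : ∀ᶠ t in 𝓝 0, f t = 0 := by
  refine hf.eventually_eq_zero_of_iteratedDeriv fun b => ?_
  have hb := h b
  simp only [coeff4, Function.iterate_zero, id_eq, pdz_iterate, pdc_iterate, pdu_iterate, hF,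
    iteratedDeriv_const_mul_field, iteratedDeriv_mul_const_field, iteratedDeriv_fun_pow_zero] at hb
  simpa [hk, Nat.factorial_ne_zero] using hb

/-- The derivatives at `0` of order at most two of `A + B u + C u ^ 2 + O(u ^ 3)`. -/
lemma iteratedDeriv_quadratic_add_cube_mul (A B C : ℂ) {Q : ℂ → ℂ} (hQ : AnalyticAt ℂ Q 0)
    {c : ℕ} (hc : c < 3) :
    iteratedDeriv c (fun u => A * u ^ 0 + B * u ^ 1 + C * u ^ 2 + u ^ 3 * Q u) 0 =
      (if c = 0 then A else 0) + (if c = 1 then B else 0) + (if c = 2 then 2 * C else 0) := by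
  have han : AnalyticAt ℂ (fun u => u ^ 3 * Q u) 0 := by fun_prop
  have h3 : iteratedDeriv c (fun u => u ^ 3 * Q u) 0 = 0 := by
    refine (natCast_le_analyticOrderAt_iff_iteratedDeriv_eq_zero han).1 ?_ c hc
    refine (natCast_le_analyticOrderAt han).2 ⟨Q, hQ, ?_⟩
    simp
  rw [iteratedDeriv_fun_add (by fun_prop) han.contDiffAt, h3,
    iteratedDeriv_fun_add (by fun_prop) (by fun_prop),
    iteratedDeriv_fun_add (by fun_prop) (by fun_prop)]
  simp only [iteratedDeriv_const_mul_field, iteratedDeriv_fun_pow_zero]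
  interval_cases c <;> simp [mul_comm]

/-- for weight `ν ≥ 5`, if all Taylor coefficients of the polarized freedom
function `Φ` attached to monomials `z^a ζ^b u^c v^d` with `c ≤ 2` and `d = 0` vanish, then
the weighted homogeneous map components `φ, ψ, χ` all vanish near `0`. -/
theorem stmt14
    (ν : ℕ) (hν : 5 ≤ ν) (φ ψ χ : ℂ → ℂ)
    (hφ : AnalyticAt ℂ φ 0) (hψ : AnalyticAt ℂ ψ 0) (hχ : AnalyticAt ℂ χ 0)
    (hcoeff : ∀ a b c : ℕ, c ≤ 2 →
      coeff4 (fun z ζ u v =>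
        (u + z * v) / (1 - ζ * v) * (z ^ (ν - 1) * φ ζ) +
          (u + z * v) ^ 2 / (2 * (1 - ζ * v) ^ 2) * (z ^ (ν - 2) * ψ ζ) -
          (1 / 2) * (z ^ ν * χ ζ) +
          (z + u * ζ) / (1 - ζ * v) * (u ^ (ν - 1) * conj (φ (conj v))) +
          (z + u * ζ) ^ 2 / (2 * (1 - ζ * v) ^ 2) * (u ^ (ν - 2) * conj (ψ (conj v))) -
          (1 / 2) * (u ^ ν * conj (χ (conj v)))) a b c 0 = 0) :
    ∀ᶠ t in 𝓝 (0 : ℂ), φ t = 0 ∧ ψ t = 0 ∧ χ t = 0 := by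
  obtain ⟨n, rfl⟩ := Nat.exists_eq_add_of_le' hν
  set Φ : ℂ → ℂ → ℂ → ℂ → ℂ := _ with hΦ
  change ∀ a b c : ℕ, c ≤ 2 → coeff4 Φ a b c 0 = 0 at hcoeff
  have key : ∀ c < 3, ∀ z ζ, iteratedDeriv c (fun u => Φ z ζ u 0) 0 =
      (if c = 0 then -(1 / 2) * (z ^ (n + 5) * χ ζ) else 0) +
        (if c = 1 then z ^ (n + 4) * φ ζ else 0) +
        (if c = 2 then 2 * (1 / 2 * (z ^ (n + 3) * ψ ζ)) else 0) := by
    intro c hc z ζ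
    rw [← iteratedDeriv_quadratic_add_cube_mul _ _ _ (Q := fun u =>
      (z + u * ζ) * (u ^ (n + 1) * conj (φ 0)) + (z + u * ζ) ^ 2 / 2 * (u ^ n * conj (ψ 0)) -
        1 / 2 * (u ^ (n + 2) * conj (χ 0))) (by fun_prop) hc]
    congr 1
    funext u
    simp only [hΦ, mul_zero, sub_zero, map_zero, add_zero, div_one, one_pow,
      show n + 5 - 1 = n + 4 from rfl, show n + 5 - 2 = n + 3 from rfl]
    ring
  have hφ0 := eventually_eq_zero_of_coeff4 (F := Φ) (m := n + 4) (c := 1) hφ one_ne_zero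
    (fun z ζ => by rw [key 1 (by norm_num)]; simp) (fun b => hcoeff _ b _ (by norm_num))
  have hψ0 := eventually_eq_zero_of_coeff4 (F := Φ) (m := n + 3) (c := 2) hψ one_ne_zero
    (fun z ζ => by rw [key 2 (by norm_num)]; simp) (fun b => hcoeff _ b _ le_rfl)
  have hχ0 := eventually_eq_zero_of_coeff4 (F := Φ) (m := n + 5) (c := 0) (k := -(1 / 2)) hχ
    (by norm_num) (fun z ζ => by rw [key 0 (by norm_num)]; simp)
    (fun b => hcoeff _ b _ (by norm_num))
  filter_upwards [hφ0, hψ0, hχ0] with t h₁ h₂ h₃ using ⟨h₁, h₂, h₃⟩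
end
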